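/- Let P = {x ∈ ℝ^n : A x ≤ b} be a nonempty polyhedron with nonempty interior. For θ ∈ ℝ^n, the integral ∫_P e^{⟨θ,x⟩} dx (with respect to Lebesgue measure) is finite if and only if θ belongs to the interior of the polar cone of the recession cone of P. -/

import Mathlib

open MeasureTheory Real

open scoped Matrix Nat

/-- On a finite-dimensional space, `x ↦ exp (-δ ‖x‖)` is integrable for `δ > 0`. -/
theorem integrable_exp_neg_mul_norm {E : Type*} [NormedAddCommGroup E] [NormedSpace ℝ E]
    [FiniteDimensional ℝ E] [MeasurableSpace E] [BorelSpace E] (μ : Measure E)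
    [μ.IsAddHaarMeasure] {δ : ℝ} (hδ : 0 < δ) :
    Integrable (fun x : E => exp (-(δ * ‖x‖))) μ := by
  set k := Module.finrank ℝ E + 1 with hk
  have hr : (Module.finrank ℝ E : ℝ) < (k : ℝ) := by rw [hk]; push_cast; linarith
  refine ((integrable_one_add_norm (μ := μ) hr).const_mul (exp δ * (k ! / δ ^ k))).mono'
    (by fun_prop) (ae_of_all _ fun x => ?_)
  have h1 : (0 : ℝ) < 1 + ‖x‖ := by positivity
  have h2 := pow_div_factorial_le_exp (x := δ * (1 + ‖x‖)) (by positivity) k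
  have h3 : exp (-(δ * ‖x‖)) = exp δ * (exp (δ * (1 + ‖x‖)))⁻¹ := by
    rw [← exp_neg, ← exp_add]; ring_nf
  have h4 : (k ! / δ ^ k) * (1 + ‖x‖) ^ (-(k : ℝ)) = ((δ * (1 + ‖x‖)) ^ k / k !)⁻¹ := by
    rw [rpow_neg h1.le, rpow_natCast, mul_pow]
    field_simp
  rw [norm_of_nonneg (exp_pos _).le, h3, mul_assoc, h4]
  gcongr

/-- If a linear functional `θ` is negative on the nonzero points of the cone `{z | A z ≤ 0}`, then
it is bounded above by `-δ ‖x‖` up to a multiple of the violation of the inequalities `A x ≤ 0`. -/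
theorem exists_dotProduct_le_neg_mul_norm_add {m n : Type*} [Fintype m] [Fintype n]
    (A : Matrix m n ℝ) (θ : n → ℝ) (h : ∀ z, A *ᵥ z ≤ 0 → z ≠ 0 → θ ⬝ᵥ z < 0) :
    ∃ δ > 0, ∃ M : ℝ, 0 ≤ M ∧
      ∀ x, θ ⬝ᵥ x ≤ -(δ * ‖x‖) + M * ∑ i, max ((A *ᵥ x) i) 0 := by
  have hg0 (x : n → ℝ) : 0 ≤ ∑ i, max ((A *ᵥ x) i) 0 :=
    Finset.sum_nonneg fun i _ => le_max_right _ _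
  obtain ⟨M, hM⟩ := (isCompact_sphere (0 : n → ℝ) 1).elim_directed_cover
    (fun M : ℕ => {u | θ ⬝ᵥ u - M * ∑ i, max ((A *ᵥ u) i) 0 < 0})
    (fun M => isOpen_lt (by fun_prop) continuous_const)
    (fun u hu => by
      have hu0 : u ≠ 0 := by rintro rfl; simp at hu
      rw [Set.mem_iUnion]
      rcases (hg0 u).eq_or_lt with h0 | h0
      · refine ⟨0, ?_⟩
        have hA : A *ᵥ u ≤ 0 := fun i => by
          have := (Finset.sum_eq_zero_iff_of_nonneg fun i _ => le_max_right _ _).1 h0.symm i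
            (Finset.mem_univ i)
          exact max_eq_right_iff.1 this
        simpa using h u hA hu0
      · obtain ⟨M, hM⟩ := exists_nat_gt (θ ⬝ᵥ u / ∑ i, max ((A *ᵥ u) i) 0)
        exact ⟨M, sub_neg.2 ((div_lt_iff₀ h0).1 hM)⟩)
    (directed_of_isDirected_le fun M N hMN u hu => by
      have : (M : ℝ) * ∑ i, max ((A *ᵥ u) i) 0 ≤ N * ∑ i, max ((A *ᵥ u) i) 0 :=
        mul_le_mul_of_nonneg_right (by exact_mod_cast hMN) (hg0 u)
      simp only [Set.mem_ofPred_eq] at hu ⊢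
      linarith)
  obtain ⟨δ, hδ, hδM⟩ : ∃ δ > 0, ∀ u ∈ Metric.sphere (0 : n → ℝ) 1,
      θ ⬝ᵥ u - M * ∑ i, max ((A *ᵥ u) i) 0 ≤ -δ := by
    rcases (Metric.sphere (0 : n → ℝ) 1).eq_empty_or_nonempty with he | hne
    · exact ⟨1, one_pos, by simp [he]⟩
    · obtain ⟨u, hu, hmax⟩ := (isCompact_sphere (0 : n → ℝ) 1).exists_isMaxOn hne
        (f := fun u => θ ⬝ᵥ u - M * ∑ i, max ((A *ᵥ u) i) 0) (by fun_prop)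
      exact ⟨-(θ ⬝ᵥ u - M * ∑ i, max ((A *ᵥ u) i) 0), neg_pos.2 (hM hu),
        fun v hv => by rw [neg_neg]; exact hmax hv⟩
  refine ⟨δ, hδ, M, M.cast_nonneg, fun x => ?_⟩
  rcases eq_or_ne x 0 with rfl | hx
  · simp
  have hpos : 0 < ‖x‖ := norm_pos_iff.2 hx
  obtain ⟨u, hu, hxu⟩ : ∃ u : n → ℝ, ‖u‖ = 1 ∧ x = ‖x‖ • u :=
    ⟨‖x‖⁻¹ • x, by rw [norm_smul, norm_inv, norm_norm, inv_mul_cancel₀ hpos.ne'],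
      by rw [smul_inv_smul₀ hpos.ne']⟩
  have key := hδM u (by simpa using hu)
  have hsum : ∑ i, max ((A *ᵥ x) i) 0 = ‖x‖ * ∑ i, max ((A *ᵥ u) i) 0 := by
    rw [Finset.mul_sum]
    refine Finset.sum_congr rfl fun i _ => ?_
    rw [mul_max_of_nonneg _ _ hpos.le, mul_zero]
    conv_lhs => rw [hxu]
    rw [Matrix.mulVec_smul, Pi.smul_apply, smul_eq_mul]
  have hdot : θ ⬝ᵥ x = ‖x‖ * (θ ⬝ᵥ u) := by
    conv_lhs => rw [hxu]
    rw [dotProduct_smul, smul_eq_mul]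
  rw [hsum, hdot]
  nlinarith [mul_le_mul_of_nonneg_left key hpos.le]

/-- The recession directions of a nonempty polyhedron `{x | A x ≤ b}` are the solutions of
`A z ≤ 0`. -/
theorem exists_forall_add_smul_mulVec_le_iff {m n : Type*} [Fintype n]
    {A : Matrix m n ℝ} {b : m → ℝ} {x₀ : n → ℝ} (hx₀ : A *ᵥ x₀ ≤ b) (z : n → ℝ) :
    (∃ x, A *ᵥ x ≤ b ∧ ∀ t : ℝ, 0 ≤ t → A *ᵥ (x + t • z) ≤ b) ↔ A *ᵥ z ≤ 0 := by
  simp only [Matrix.mulVec_add, Matrix.mulVec_smul]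
  constructor
  · rintro ⟨x, -, h⟩ i
    by_contra! hi
    rw [Pi.zero_apply] at hi
    obtain ⟨k, hk⟩ := exists_nat_gt ((b i - (A *ᵥ x) i) / (A *ᵥ z) i)
    have h1 := h k k.cast_nonneg i
    rw [div_lt_iff₀ hi] at hk
    simp only [Pi.add_apply, Pi.smul_apply, smul_eq_mul] at h1
    linarith
  · intro hz
    refine ⟨x₀, hx₀, fun t ht i => ?_⟩
    have h1 := mul_nonpos_of_nonneg_of_nonpos ht (hz i)
    have h2 := hx₀ i
    simp only [Pi.add_apply, Pi.smul_apply, smul_eq_mul]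
    linarith

/-- The interior of the polar of the cone `{z | A z ≤ 0}` consists of the functionals that are
negative on the nonzero points of the cone. -/
theorem mem_interior_polar_iff {m n : Type*} [Fintype m] [Fintype n]
    (A : Matrix m n ℝ) (θ : n → ℝ) :
    θ ∈ interior {y : n → ℝ | ∀ z, A *ᵥ z ≤ 0 → y ⬝ᵥ z ≤ 0} ↔
      ∀ z, A *ᵥ z ≤ 0 → z ≠ 0 → θ ⬝ᵥ z < 0 := by
  constructor
  · intro hθ z hz hz0
    have hc : Filter.Tendsto (fun s : ℝ => θ + s • z) (nhdsWithin 0 (Set.Ioi 0)) (nhds θ) := by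
      have : Continuous fun s : ℝ => θ + s • z := by fun_prop
      simpa using (this.tendsto 0).mono_left nhdsWithin_le_nhds
    obtain ⟨s, hs, hs0⟩ := ((hc.eventually (mem_interior_iff_mem_nhds.1 hθ)).and
      self_mem_nhdsWithin).exists
    have h1 := hs z hz
    rw [add_dotProduct, smul_dotProduct, smul_eq_mul] at h1
    have h2 : 0 < z ⬝ᵥ z := (Finset.sum_nonneg fun i _ => mul_self_nonneg (z i)).lt_of_ne'
      (mt dotProduct_self_eq_zero.1 hz0)
    have h3 := mul_pos hs0 h2
    linarith
  · intro h
    obtain ⟨δ, hδ, M, -, hM⟩ := exists_dotProduct_le_neg_mul_norm_add A θ h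
    have hc : Filter.Tendsto (fun y : n → ℝ => ∑ i, |y i - θ i|) (nhds θ) (nhds 0) := by
      have : Continuous fun y : n → ℝ => ∑ i, |y i - θ i| := by fun_prop
      simpa using this.tendsto θ
    rw [mem_interior_iff_mem_nhds]
    filter_upwards [hc.eventually (gt_mem_nhds hδ)] with y hy z hz
    have h1 : ∑ i, max ((A *ᵥ z) i) 0 = 0 :=
      Finset.sum_eq_zero fun i _ => max_eq_right (hz i)
    have h2 := hM z
    rw [h1, mul_zero, add_zero] at h2
    have h3 : (y - θ) ⬝ᵥ z ≤ (∑ i, |y i - θ i|) * ‖z‖ := by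
      rw [Finset.sum_mul]
      refine Finset.sum_le_sum fun i _ => (le_abs_self _).trans ?_
      rw [abs_mul]
      exact mul_le_mul_of_nonneg_left (norm_le_pi_norm z i) (abs_nonneg _)
    rw [sub_dotProduct] at h3
    nlinarith [mul_le_mul_of_nonneg_right hy.le (norm_nonneg z)]

/-- If `θ` is negative on the nonzero points of `{z | A z ≤ 0}`, then `exp ⟨θ, x⟩` is integrable
on `{x | A x ≤ b}`. -/
theorem integrableOn_exp_dotProduct {m n : Type*} [Fintype m] [Fintype n]
    (A : Matrix m n ℝ) (b : m → ℝ) (θ : n → ℝ)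
    (h : ∀ z, A *ᵥ z ≤ 0 → z ≠ 0 → θ ⬝ᵥ z < 0) :
    IntegrableOn (fun x => exp (θ ⬝ᵥ x)) {x | A *ᵥ x ≤ b} volume := by
  obtain ⟨δ, hδ, M, hM0, hM⟩ := exists_dotProduct_le_neg_mul_norm_add A θ h
  have hmeas : MeasurableSet {x : n → ℝ | A *ᵥ x ≤ b} :=
    (isClosed_le (by fun_prop) continuous_const).measurableSet
  refine (((integrable_exp_neg_mul_norm volume hδ).const_mul
    (exp (M * ∑ i, max (b i) 0))).integrableOn).mono' (by fun_prop)
    ((ae_restrict_iff' hmeas).2 (ae_of_all _ fun x hx => ?_))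
  rw [norm_of_nonneg (exp_pos _).le, ← exp_add, exp_le_exp]
  have h1 : ∑ i, max ((A *ᵥ x) i) 0 ≤ ∑ i, max (b i) 0 :=
    Finset.sum_le_sum fun i _ => max_le_max_right 0 (hx i)
  linarith [hM x, mul_le_mul_of_nonneg_left h1 hM0]

/-- If `exp ⟨θ, x⟩` is integrable on a set with nonempty interior that is stable under translation
by `z ≠ 0`, then `⟨θ, z⟩ < 0`. -/
theorem dotProduct_neg_of_integrableOn_exp {n : Type*} [Fintype n] {P : Set (n → ℝ)}
    (hP : (interior P).Nonempty) {θ z : n → ℝ} (hz : z ≠ 0) (hPz : ∀ x ∈ P, x + z ∈ P)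
    (hint : IntegrableOn (fun x => exp (θ ⬝ᵥ x)) P volume) : θ ⬝ᵥ z < 0 := by
  by_contra! hθz
  obtain ⟨x₀, hx₀⟩ := hP
  have hθ : Continuous fun x : n → ℝ => θ ⬝ᵥ x := by fun_prop
  obtain ⟨ρ, hρ, hball⟩ := Metric.mem_nhds_iff.1 (Filter.inter_mem
    (mem_interior_iff_mem_nhds.1 hx₀)
    (hθ.continuousAt.eventually (lt_mem_nhds (sub_one_lt (θ ⬝ᵥ x₀)))))
  set r := min ρ (‖z‖ / 2)
  have hr0 : 0 < r := lt_min hρ (half_pos (norm_pos_iff.2 hz))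
  let B : ℕ → Set (n → ℝ) := fun k => Metric.ball (x₀ + (k : ℝ) • z) r
  have hPk (k : ℕ) : ∀ x ∈ P, x + (k : ℝ) • z ∈ P := by
    induction k with
    | zero => simp
    | succ k ih =>
      intro x hx
      rw [Nat.cast_add_one, add_smul, one_smul, ← add_assoc]
      exact hPz _ (ih x hx)
  have hB (k : ℕ) : B k ⊆ {x | exp (θ ⬝ᵥ x₀ - 1) ≤ exp (θ ⬝ᵥ x)} ∩ P := by
    intro x hx
    have hx' : x - (k : ℝ) • z ∈ Metric.ball x₀ ρ := by
      rw [Metric.mem_ball, dist_eq_norm] at hx ⊢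
      rw [sub_sub, add_comm (_ • z)]
      exact hx.trans_le (min_le_left _ _)
    obtain ⟨h1, h2⟩ := hball hx'
    refine ⟨exp_le_exp.2 ?_, by simpa using hPk k _ h1⟩
    simp only [Set.mem_ofPred_eq, dotProduct_sub, dotProduct_smul, smul_eq_mul] at h2
    nlinarith [mul_nonneg k.cast_nonneg hθz]
  have hdisj : Pairwise (Function.onFun Disjoint B) := by
    intro k l hkl
    refine Metric.ball_disjoint_ball ?_
    rw [dist_add_left, dist_eq_norm, ← sub_smul, norm_smul]
    have h1 : (1 : ℝ) ≤ ‖(k : ℝ) - l‖ := by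
      have : (1 : ℤ) ≤ |(k : ℤ) - l| := Int.one_le_abs (by omega)
      rw [norm_eq_abs]
      exact_mod_cast this
    have h2 : r ≤ ‖z‖ / 2 := min_le_right _ _
    nlinarith [norm_nonneg z]
  have hfin : volume (⋃ k, B k) < ⊤ := by
    have h1 : Integrable (fun x => exp (θ ⬝ᵥ x)) (volume.restrict P) := hint
    have h2 := h1.measure_ge_lt_top (exp_pos (θ ⬝ᵥ x₀ - 1))
    have h3 : MeasurableSet {x : n → ℝ | exp (θ ⬝ᵥ x₀ - 1) ≤ exp (θ ⬝ᵥ x)} :=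
      (isClosed_le continuous_const (by fun_prop)).measurableSet
    rw [Measure.restrict_apply h3] at h2
    exact (measure_mono (Set.iUnion_subset hB)).trans_lt h2
  rw [measure_iUnion hdisj fun k => Metric.isOpen_ball.measurableSet] at hfin
  have hconst (k : ℕ) : volume (B k) = volume (Metric.ball (0 : n → ℝ) r) :=
    Measure.addHaar_ball_center _ _ _
  simp only [hconst] at hfin
  rw [ENNReal.tsum_const_eq_top_of_ne_zero (Metric.measure_ball_pos _ _ hr0).ne'] at hfin
  exact lt_irrefl _ hfin

/-- For a nonempty polyhedron `P = {x : Ax ≤ b}` with nonempty interior, the integral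
`∫_P e^{⟨θ,x⟩} dx` is finite if and only if `θ` lies in the interior of the polar cone of
the recession cone of `P`. -/
theorem laplace_transform_finite_iff
    (n m : ℕ) (A : Matrix (Fin m) (Fin n) ℝ) (b : Fin m → ℝ)
    (P : Set (Fin n → ℝ)) (hP : P = {x | ∀ i, ∑ j, A i j * x j ≤ b i})
    (hPne : P.Nonempty) (hPint : (interior P).Nonempty)
    -- the recession cone of `P`
    (recP : Set (Fin n → ℝ))
    (hrecP : recP = {z | ∃ x ∈ P, ∀ t : ℝ, 0 ≤ t → x + t • z ∈ P})
    (θ : Fin n → ℝ) :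
    IntegrableOn (fun x => exp (∑ i, θ i * x i)) P volume ↔
      θ ∈ interior {y : Fin n → ℝ | ∀ z ∈ recP, ∑ i, y i * z i ≤ 0} := by
  obtain ⟨x₀, hx₀⟩ := hPne
  have hP' : P = {x | A *ᵥ x ≤ b} := hP
  have hrec (z : Fin n → ℝ) : z ∈ recP ↔ A *ᵥ z ≤ 0 := by
    rw [hP'] at hx₀
    rw [hrecP, hP']
    exact exists_forall_add_smul_mulVec_le_iff hx₀ z
  simp only [hrec]
  refine Iff.trans ?_ (mem_interior_polar_iff A θ).symm
  constructor
  · intro hint z hz hz0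
    refine dotProduct_neg_of_integrableOn_exp hPint hz0 (fun x hx => ?_) hint
    rw [hP'] at hx ⊢
    have h1 : A *ᵥ x + A *ᵥ z ≤ b + 0 := add_le_add hx hz
    rwa [← Matrix.mulVec_add, add_zero] at h1
  · intro h
    rw [hP']
    exact integrableOn_exp_dotProduct A b θ h
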